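/- arXiv:math/0105002 — 2 statements merged into one kernel-verified Lean document; each statement's English description precedes it below -/
import Mathlib

section
/- Ramanujan's partial theta identity: Σ_{n≥0} (q^{n+1};q)_n q^n / ((a;q)_{n+1} (q/a;q)_n) = Σ_{n≥0} a^n q^{n(n+1)} + Σ_{n≥0} a^{3n+1} q^{n(3n+2)} (1 - a q^{2n+1}) / ((a;q)_∞ (q/a;q)_∞). -/
open scoped BigOperators

/-- finite q-Pochhammer symbol `(x;q)_n = ∏_{j=0}^{n-1} (1 - x q^j)` -/
noncomputable def qPoch (x q : ℂ) (n : ℕ) : ℂ := ∏ j ∈ Finset.range n, (1 - x * q ^ j)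

/-- infinite q-Pochhammer symbol `(x;q)_∞ = ∏_{j≥0} (1 - x q^j)` -/
noncomputable def qPochInf (x q : ℂ) : ℂ := ∏' j : ℕ, (1 - x * q ^ j)

/-- Gaussian binomial coefficient in base q, zero outside `0 ≤ k ≤ m`. -/
noncomputable def qbinom (q : ℂ) (m k : ℤ) : ℂ :=
  if 0 ≤ k ∧ k ≤ m then
    qPoch q q m.toNat / (qPoch q q k.toNat * qPoch q q (m - k).toNat)
  else 0

open Filter Topology

lemma qPoch_succ (x q : ℂ) (n : ℕ) : qPoch x q (n + 1) = qPoch x q n * (1 - x * q ^ n) := by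
  simp [qPoch, Finset.prod_range_succ]

lemma qPoch_add (x q : ℂ) (n m : ℕ) :
    qPoch x q (n + m) = qPoch x q n * qPoch (x * q ^ n) q m := by
  simp only [qPoch, Finset.prod_range_add]
  congr 1
  exact Finset.prod_congr rfl fun j _ => by ring

lemma qPoch_one (x q : ℂ) : qPoch x q 1 = 1 - x := by simp [qPoch]

lemma qPoch_shift (x q : ℂ) (n : ℕ) :
    (1 - x) * qPoch (x * q) q n = qPoch x q n * (1 - x * q ^ n) := by
  rw [← qPoch_succ, add_comm, qPoch_add, qPoch_one, pow_one]

lemma qPoch_ne (x q : ℂ) (h : ∀ j : ℕ, 1 - x * q ^ j ≠ 0) (n : ℕ) : qPoch x q n ≠ 0 :=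
  Finset.prod_ne_zero_iff.2 fun j _ => h j

lemma summ_aux (x q : ℂ) (hq : ‖q‖ < 1) : Summable fun j : ℕ => ‖-(x * q ^ j)‖ := by
  simp only [norm_neg, norm_mul, norm_pow]
  exact (summable_geometric_of_lt_one (norm_nonneg _) hq).mul_left _

lemma mult_aux (x q : ℂ) (hq : ‖q‖ < 1) : Multipliable fun j : ℕ => (1 - x * q ^ j) := by
  simpa [sub_eq_add_neg] using multipliable_one_add_of_summable (summ_aux x q hq)

lemma qPoch_tendsto (x q : ℂ) (hq : ‖q‖ < 1) :
    Tendsto (fun n => qPoch x q n) atTop (𝓝 (qPochInf x q)) :=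
  (mult_aux x q hq).tendsto_prod_tprod_nat

lemma qPochInf_ne (x q : ℂ) (hq : ‖q‖ < 1) (h : ∀ j : ℕ, 1 - x * q ^ j ≠ 0) :
    qPochInf x q ≠ 0 := by
  have := tprod_one_add_ne_zero_of_summable (f := fun j : ℕ => -(x * q ^ j))
    (fun j => by simpa [sub_eq_add_neg] using h j) (summ_aux x q hq)
  simpa [qPochInf, sub_eq_add_neg] using this

lemma qPochInf_shift (x q : ℂ) (hq : ‖q‖ < 1) :
    qPochInf x q = (1 - x) * qPochInf (x * q) q := by
  have h1 := (qPoch_tendsto x q hq).comp (tendsto_add_atTop_nat 1)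
  have h2 := (qPoch_tendsto (x * q) q hq).const_mul (1 - x)
  refine tendsto_nhds_unique h1 (h2.congr fun n => ?_)
  simp [qPoch_shift, qPoch_succ]

lemma bdd_of_tendsto {u : ℕ → ℂ} {l : ℂ} (h : Tendsto u atTop (𝓝 l)) :
    ∃ C, 0 < C ∧ ∀ n, ‖u n‖ ≤ C := by
  obtain ⟨C, hC⟩ := (Metric.isBounded_range_of_tendsto u h).exists_norm_le
  exact ⟨max C 1, by positivity, fun n => (hC _ ⟨n, rfl⟩).trans (le_max_left _ _)⟩

/-- nondegeneracy of the base point -/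
def Gd (q a : ℂ) : Prop := a ≠ 0 ∧ ∀ n : ℤ, a ≠ q ^ n

lemma Gd.mul {q a : ℂ} (hq0 : q ≠ 0) (h : Gd q a) : Gd q (a * q) := by
  refine ⟨mul_ne_zero h.1 hq0, fun n hn => h.2 (n - 1) ?_⟩
  rw [zpow_sub_one₀ hq0, ← hn]
  field_simp

lemma Gd.mul_pow {q a : ℂ} (hq0 : q ≠ 0) (h : Gd q a) (m : ℕ) : Gd q (a * q ^ m) := by
  induction m with
  | zero => simpa using h
  | succ m ih => simpa [pow_succ, mul_assoc] using ih.mul hq0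

lemma Gd.ne1 {q a : ℂ} (hq0 : q ≠ 0) (h : Gd q a) (j : ℕ) : 1 - a * q ^ j ≠ 0 := by
  intro e
  apply h.2 (-(j : ℤ))
  rw [zpow_neg, zpow_natCast]
  exact eq_inv_of_mul_eq_one_left (sub_eq_zero.1 e).symm

lemma Gd.ne2 {q a : ℂ} (h : Gd q a) (j : ℕ) : 1 - q / a * q ^ j ≠ 0 := by
  intro e
  apply h.2 ((j + 1 : ℕ) : ℤ)
  rw [zpow_natCast]
  have ha := h.1
  field_simp at e
  rw [pow_succ]
  linear_combination e

lemma one_sub_ne {q : ℂ} (hq : ‖q‖ < 1) (j : ℕ) : 1 - q * q ^ j ≠ 0 := by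
  intro e
  have : ‖q ^ (j + 1)‖ < 1 := by
    rw [norm_pow]; exact pow_lt_one₀ (norm_nonneg _) hq (by omega)
  rw [pow_succ', ← sub_eq_zero.1 e] at this
  simp at this

/-- numerator -/
noncomputable def uN (q : ℂ) (n : ℕ) : ℂ := qPoch (q ^ (n + 1)) q n

lemma uN_eq (q : ℂ) (hq : ‖q‖ < 1) (n : ℕ) : uN q n = qPoch q q (n + n) / qPoch q q n := by
  rw [qPoch_add, uN, pow_succ', mul_div_cancel_left₀ _ (qPoch_ne _ _ (one_sub_ne hq) n)]

lemma uN_succ (q : ℂ) (hq : ‖q‖ < 1) (n : ℕ) :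
    uN q (n + 1) = uN q n * ((1 - q * (q ^ n) ^ 2) * (1 + q * q ^ n)) := by
  have h1 := qPoch_ne _ _ (one_sub_ne hq) n
  have h2 := one_sub_ne hq n
  rw [uN_eq q hq, uN_eq q hq, show n + 1 + (n + 1) = (n + n) + 1 + 1 by ring, qPoch_succ,
    qPoch_succ, qPoch_succ]
  field_simp
  ring

lemma uN_tendsto (q : ℂ) (hq : ‖q‖ < 1) : Tendsto (uN q) atTop (𝓝 1) := by
  have h := qPoch_tendsto q q hq
  have hne := qPochInf_ne q q hq (one_sub_ne hq)
  have h2 := h.comp (tendsto_atTop_mono (fun n : ℕ => (by omega : n ≤ n + n)) tendsto_id)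
  have := h2.div h hne
  rw [div_self hne] at this
  exact this.congr fun n => (uN_eq q hq n).symm

/-- summand -/
noncomputable def sT (q a : ℂ) (n : ℕ) : ℂ :=
  uN q n * q ^ n / (qPoch a q (n + 1) * qPoch (q / a) q n)

lemma sT_shift {q a : ℂ} (hq0 : q ≠ 0) (h : Gd q a) (n : ℕ) :
    sT q (a * q) n * (1 - a * q ^ (n + 1)) = sT q a n * (q ^ n - a) := by
  have ha := h.1
  have h1 := qPoch_ne _ _ (h.ne1 hq0) (n + 1)
  have h2 := qPoch_ne _ _ h.ne2 n
  have h3 := qPoch_ne _ _ ((h.mul hq0).ne1 hq0) (n + 1)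
  have h4 := qPoch_ne _ _ (h.mul hq0).ne2 n
  have e1 := qPoch_shift a q (n + 1)
  have e2 := qPoch_shift (q / (a * q)) q n
  rw [show q / (a * q) * q = q / a by field_simp] at e2
  have e3 : (a - 1) * qPoch (q / a) q n = qPoch (q / (a * q)) q n * (a - q ^ n) := by
    have : (a - 1) * qPoch (q / a) q n = a * ((1 - q / (a * q)) * qPoch (q / a) q n) := by
      field_simp
    rw [this, e2]
    field_simp
  have hn : (1 : ℂ) - a ≠ 0 := by simpa using h.ne1 hq0 0
  unfold sT
  rw [div_mul_eq_mul_div, div_mul_eq_mul_div, div_eq_div_iff (mul_ne_zero h3 h4)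
    (mul_ne_zero h1 h2)]
  apply mul_left_cancel₀ hn
  linear_combination (-uN q n * q ^ n * qPoch (q / a) q n * (1 - a)) * e1
    + (-uN q n * q ^ n * qPoch (a * q) q (n + 1) * (1 - a)) * e3

lemma sT_shift_pow {q a : ℂ} (hq0 : q ≠ 0) (h : Gd q a) (n m : ℕ) :
    sT q (a * q ^ m) n * qPoch (a * q ^ (n + 1)) q m
      = sT q a n * ∏ k ∈ Finset.range m, (q ^ n - a * q ^ k) := by
  induction m with
  | zero => simp [qPoch]
  | succ m ih =>
    have := sT_shift hq0 (h.mul_pow hq0 m) n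
    rw [qPoch_succ, Finset.prod_range_succ, ← mul_assoc (sT q a n), ← ih, pow_succ, ← mul_assoc a]
    have e : a * q ^ (n + 1) * q ^ m = a * q ^ m * q ^ (n + 1) := by ring
    rw [e]
    linear_combination (qPoch (a * q ^ (n + 1)) q m) * this

lemma prod_bd {q a : ℂ} (hq : ‖q‖ < 1) : ∃ C, 0 < C ∧ ∀ n m : ℕ,
    ‖∏ k ∈ Finset.range m, (q ^ n - a * q ^ k)‖ ≤ C := by
  refine ⟨Real.exp (∑' k : ℕ, ‖a‖ * ‖q‖ ^ k), Real.exp_pos _, fun n m => ?_⟩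
  have hs : Summable fun k : ℕ => ‖a‖ * ‖q‖ ^ k :=
    (summable_geometric_of_lt_one (norm_nonneg _) hq).mul_left _
  calc ‖∏ k ∈ Finset.range m, (q ^ n - a * q ^ k)‖
      ≤ ∏ k ∈ Finset.range m, (1 + ‖a‖ * ‖q‖ ^ k) := by
        rw [norm_prod]
        refine Finset.prod_le_prod (fun _ _ => norm_nonneg _) fun k _ => ?_
        refine (norm_sub_le _ _).trans ?_
        rw [norm_mul, norm_pow, norm_pow]
        gcongr
        exact pow_le_one₀ (norm_nonneg _) hq.le
    _ ≤ Real.exp (∑ k ∈ Finset.range m, ‖a‖ * ‖q‖ ^ k) :=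
        Real.prod_one_add_le_exp_sum _ fun k => by positivity
    _ ≤ _ := Real.exp_le_exp.2 (hs.sum_le_tsum _ fun k _ => by positivity)

lemma sT_bd {q a : ℂ} (hq : ‖q‖ < 1) (hq0 : q ≠ 0) (h : Gd q a) :
    ∃ C, ∀ n m : ℕ, ‖sT q (a * q ^ m) n‖ ≤ C * ‖q‖ ^ n := by
  have t1 := qPoch_tendsto a q hq
  have n1 := qPochInf_ne a q hq (h.ne1 hq0)
  have t2 := qPoch_tendsto (q / a) q hq
  have n2 := qPochInf_ne (q / a) q hq h.ne2
  obtain ⟨A, hA, bA⟩ := bdd_of_tendsto (t1.inv₀ n1)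
  obtain ⟨B, hB, bB⟩ := bdd_of_tendsto (t2.inv₀ n2)
  obtain ⟨U, hU, bU⟩ := bdd_of_tendsto (uN_tendsto q hq)
  obtain ⟨P, hP, bP⟩ := prod_bd (a := a) hq
  refine ⟨U * B * P * A, fun n m => ?_⟩
  have p1 := qPoch_ne _ _ (h.ne1 hq0) (n + 1)
  have p2 := qPoch_ne _ _ (h.ne1 hq0) (n + 1 + m)
  have p3 := qPoch_ne _ _ h.ne2 n
  have e := sT_shift_pow hq0 h n m
  have e2 := qPoch_add a q (n + 1) m
  have p4 : qPoch (a * q ^ (n + 1)) q m ≠ 0 := by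
    intro h0; rw [h0, mul_zero] at e2; exact p2 e2
  have key : sT q (a * q ^ m) n = uN q n * (qPoch (q / a) q n)⁻¹ *
      (∏ k ∈ Finset.range m, (q ^ n - a * q ^ k)) * (qPoch a q (n + 1 + m))⁻¹ * q ^ n := by
    rw [← mul_left_inj' p4, e, e2, sT]
    field_simp
  rw [key, norm_mul, norm_mul, norm_mul, norm_mul, norm_pow]
  gcongr
  · exact bU n
  · exact bB n
  · exact bP n m
  · exact bA _

lemma sT_summable {q a : ℂ} (hq : ‖q‖ < 1) (hq0 : q ≠ 0) (h : Gd q a) : Summable (sT q a) := by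
  obtain ⟨C, hC⟩ := sT_bd hq hq0 h
  refine Summable.of_norm_bounded
    ((summable_geometric_of_lt_one (norm_nonneg _) hq).mul_left C) fun n => ?_
  simpa using hC n 0

/-- telescoping certificate -/
noncomputable def cT (q a : ℂ) (n : ℕ) : ℂ :=
  (1 - a * q) * (a - q ^ n) * uN q n / (qPoch a q (n + 2) * qPoch (q / a) q n)

lemma cT_diff {q a : ℂ} (hq : ‖q‖ < 1) (hq0 : q ≠ 0) (h : Gd q a) (n : ℕ) :
    sT q a n - a * q ^ 2 * sT q (a * q ^ 2) n = cT q a (n + 1) - cT q a n := by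
  have ha := h.1
  have e := sT_shift_pow hq0 h n 2
  have f1 := h.ne1 hq0 (n + 1)
  have f2 := h.ne1 hq0 (n + 2)
  have f3 := h.ne2 n
  have p1 := qPoch_ne _ _ (h.ne1 hq0) (n + 1)
  have p3 := qPoch_ne _ _ h.ne2 n
  have f3' : a - q * q ^ n ≠ 0 := by
    intro h0; apply f3; field_simp; rw [h0, mul_zero]
  have e' : sT q (a * q ^ 2) n =
      sT q a n * ((q ^ n - a) * (q ^ n - a * q)) / ((1 - a * q ^ (n + 1)) * (1 - a * q ^ (n + 2))) := by
    rw [eq_div_iff (mul_ne_zero f1 f2)]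
    simp only [qPoch, Finset.prod_range_succ, Finset.prod_range_zero, one_mul, pow_zero, mul_one,
      pow_one] at e
    rw [← e]; ring
  rw [e', cT, cT, sT, uN_succ q hq, show n + 1 + 2 = n + 1 + 1 + 1 by ring, qPoch_succ _ _ (n + 1 + 1),
    qPoch_succ _ _ (n + 1), qPoch_succ (q / a)]
  rw [show n + 1 + 1 = n + 2 by ring]
  have g1 : 1 - a * (q ^ n * q) ≠ 0 := by rwa [← pow_succ]
  have g2 : 1 - a * (q ^ n * q ^ 2) ≠ 0 := by rwa [← pow_add]
  have g3 : 1 - q / a * q ^ n = (a - q * q ^ n) / a := by field_simp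
  rw [g3]
  simp only [pow_add, pow_one]
  generalize q ^ n = x at *
  generalize qPoch a q (n + 1) = X at *
  generalize qPoch (q / a) q n = Y at *
  generalize uN q n = U at *
  clear e e' f1 f2 f3 g3
  obtain ⟨v, hv⟩ : ∃ v, v = 1 - a * (x * q) := ⟨_, rfl⟩
  obtain ⟨w, hw⟩ : ∃ w, w = 1 - a * (x * q ^ 2) := ⟨_, rfl⟩
  obtain ⟨y, hy⟩ : ∃ y, y = a - q * x := ⟨_, rfl⟩
  rw [← hv, ← hw, ← hy]
  rw [← hv] at g1
  rw [← hw] at g2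
  rw [← hy] at f3'
  rw [show a - x * q = y by rw [hy]; ring]
  field_simp
  rw [hv, hw]
  ring

lemma cT_tendsto {q a : ℂ} (hq : ‖q‖ < 1) (hq0 : q ≠ 0) (h : Gd q a) :
    Tendsto (cT q a) atTop (𝓝 ((1 - a * q) * a / (qPochInf a q * qPochInf (q / a) q))) := by
  have t1 := (qPoch_tendsto a q hq).comp (tendsto_add_atTop_nat 2)
  have n1 := qPochInf_ne a q hq (h.ne1 hq0)
  have t2 := qPoch_tendsto (q / a) q hq
  have n2 := qPochInf_ne (q / a) q hq h.ne2
  have t3 := tendsto_pow_atTop_nhds_zero_of_norm_lt_one hq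
  have := (((t3.const_sub a).const_mul (1 - a * q)).mul (uN_tendsto q hq)).div (t1.mul t2)
    (mul_ne_zero n1 n2)
  simp only [sub_zero, mul_one] at this
  exact this

lemma S_rec {q a : ℂ} (hq : ‖q‖ < 1) (hq0 : q ≠ 0) (h : Gd q a) :
    ∑' n, sT q a n = 1 + a * (1 - a * q) / (qPochInf a q * qPochInf (q / a) q)
      + a * q ^ 2 * ∑' n, sT q (a * q ^ 2) n := by
  have s1 := sT_summable hq hq0 h
  have s2 := (sT_summable hq hq0 (h.mul_pow hq0 2)).mul_left (a * q ^ 2)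
  have t := (s1.sub s2).hasSum.tendsto_sum_nat
  rw [s1.tsum_sub s2, tsum_mul_left] at t
  have t' := (cT_tendsto hq hq0 h).sub_const (cT q a 0)
  have c0 : cT q a 0 = -1 := by
    have f0 : (1 : ℂ) - a ≠ 0 := by simpa using h.ne1 hq0 0
    have f1 : (1 : ℂ) - a * q ≠ 0 := by simpa using h.ne1 hq0 1
    simp only [cT, qPoch, uN, Finset.prod_range_succ, Finset.prod_range_zero, one_mul, pow_zero,
      mul_one, pow_one, zero_add]
    field_simp
    ring
  have := tendsto_nhds_unique t (t'.congr fun n => by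
    rw [Finset.sum_congr rfl fun i _ => cT_diff hq hq0 h i, Finset.sum_range_sub])
  rw [c0] at this
  linear_combination this

lemma theta_shift {q a : ℂ} (hq : ‖q‖ < 1) (hq0 : q ≠ 0) (h : Gd q a) :
    qPochInf a q * qPochInf (q / a) q
      = - a * (qPochInf (a * q) q * qPochInf (q / (a * q)) q) := by
  have ha := h.1
  have e2 := qPochInf_shift (q / (a * q)) q hq
  rw [show q / (a * q) * q = q / a by field_simp] at e2
  rw [qPochInf_shift a q hq, e2]
  field_simp
  ring

lemma theta_shift_pow {q a : ℂ} (hq : ‖q‖ < 1) (hq0 : q ≠ 0) (h : Gd q a) (k : ℕ) :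
    qPochInf a q * qPochInf (q / a) q = a ^ (2 * k) * q ^ (k * (2 * k) - k)
      * (qPochInf (a * q ^ (2 * k)) q * qPochInf (q / (a * q ^ (2 * k))) q) := by
  induction k with
  | zero => simp
  | succ k ih =>
    have e1 := theta_shift hq hq0 (h.mul_pow hq0 (2 * k))
    have e2 := theta_shift hq hq0 (h.mul_pow hq0 (2 * k + 1))
    rw [mul_assoc a, ← pow_succ] at e1 e2
    rw [ih, e1, e2, show 2 * (k + 1) = 2 * k + 1 + 1 by ring]
    have : (k + 1) * (2 * k + 1 + 1) - (k + 1) = (k * (2 * k) - k) + (2 * k + (2 * k + 1)) := by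
      have : k ≤ k * (2 * k) := by nlinarith [Nat.zero_le k, sq_nonneg ((k : ℤ) - 1), Nat.le_mul_self k]
      have e : (k + 1) * (2 * k + 1 + 1) = k * (2 * k) + 4 * k + 2 := by ring
      omega
    rw [this]
    ring

lemma S_iter {q a : ℂ} (hq : ‖q‖ < 1) (hq0 : q ≠ 0) (h : Gd q a) (N : ℕ) :
    ∑' n, sT q a n = (∑ n ∈ Finset.range N, a ^ n * q ^ (n * (n + 1)))
      + (∑ n ∈ Finset.range N, a ^ (3 * n + 1) * q ^ (n * (3 * n + 2)) * (1 - a * q ^ (2 * n + 1)))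
          / (qPochInf a q * qPochInf (q / a) q)
      + a ^ N * q ^ (N * (N + 1)) * ∑' n, sT q (a * q ^ (2 * N)) n := by
  induction N with
  | zero => simp
  | succ N ih =>
    have hN := h.mul_pow hq0 (2 * N)
    have ha := h.1
    have d := mul_ne_zero (qPochInf_ne _ q hq (hN.ne1 hq0)) (qPochInf_ne _ q hq hN.ne2)
    rw [ih, S_rec hq hq0 hN, Finset.sum_range_succ, Finset.sum_range_succ, add_div]
    have e : a ^ N * q ^ (N * (N + 1)) * (a * q ^ (2 * N) * (1 - a * q ^ (2 * N) * q) /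
        (qPochInf (a * q ^ (2 * N)) q * qPochInf (q / (a * q ^ (2 * N))) q))
        = a ^ (3 * N + 1) * q ^ (N * (3 * N + 2)) * (1 - a * q ^ (2 * N + 1))
          / (qPochInf a q * qPochInf (q / a) q) := by
      rw [theta_shift_pow hq hq0 h N]
      have hle : N ≤ N * (2 * N) := by nlinarith [Nat.le_mul_self N]
      have : N * (3 * N + 2) = (N * (2 * N) - N) + (N * (N + 1) + 2 * N) := by
        have e1 : N * (3 * N + 2) = N * (2 * N) + N * N + 2 * N := by ring
        have e2 : N * (N + 1) = N * N + N := by ring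
        omega
      rw [this, mul_div_assoc', div_eq_div_iff d (by positivity)]
      ring
    rw [mul_assoc a (q ^ (2 * N)) (q ^ 2), ← pow_add, show 2 * N + 2 = 2 * (N + 1) by ring]
    rw [← e]
    ring

lemma summ_ratio {q c : ℂ} (hq : ‖q‖ < 1) {u : ℕ → ℂ} (hu : ∀ n, u n ≠ 0)
    (k : ℕ → ℕ) (hk : ∀ n, n ≤ k n) (hr : ∀ n, u (n + 1) = u n * (c * q ^ k n)) : Summable u := by
  refine summable_of_ratio_test_tendsto_lt_one (l := 0) zero_lt_one (Eventually.of_forall hu) ?_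
  have t : Tendsto (fun n => ‖c * q ^ k n‖) atTop (𝓝 0) := by
    have := ((tendsto_pow_atTop_nhds_zero_of_norm_lt_one hq).comp
      (tendsto_atTop_mono hk tendsto_id)).const_mul c
    simpa using this.norm
  refine t.congr fun n => ?_
  rw [hr, norm_mul (u n), mul_div_cancel_left₀ _ (norm_ne_zero_iff.2 (hu n))]

/-- Ramanujan's partial theta identity \eqref{R1}. -/
theorem stmt_7 (q a : ℂ) (hq : ‖q‖ < 1) (hq0 : q ≠ 0) (ha : a ≠ 0)
    (ha' : ∀ n : ℤ, a ≠ q ^ n) :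
    ∑' n : ℕ, qPoch (q ^ (n + 1)) q n * q ^ n / (qPoch a q (n + 1) * qPoch (q / a) q n)
      = (∑' n : ℕ, a ^ n * q ^ (n * (n + 1)))
        + (∑' n : ℕ, a ^ (3 * n + 1) * q ^ (n * (3 * n + 2)) * (1 - a * q ^ (2 * n + 1)))
            / (qPochInf a q * qPochInf (q / a) q) := by
  have h : Gd q a := ⟨ha, ha'⟩
  have s1 : Summable fun n : ℕ => a ^ n * q ^ (n * (n + 1)) :=
    summ_ratio (c := a) hq (fun n => mul_ne_zero (pow_ne_zero _ ha) (pow_ne_zero _ hq0))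
      (fun n => 2 * n + 2) (fun n => by omega) fun n => by ring
  have s2 : Summable fun n : ℕ => a ^ (3 * n + 1) * q ^ (n * (3 * n + 2)) :=
    summ_ratio (c := a ^ 3) hq (fun n => mul_ne_zero (pow_ne_zero _ ha) (pow_ne_zero _ hq0))
      (fun n => 6 * n + 5) (fun n => by omega) fun n => by ring
  have s3 : Summable fun n : ℕ => a ^ (3 * n + 2) * q ^ (n * (3 * n + 2) + (2 * n + 1)) :=
    summ_ratio (c := a ^ 3) hq (fun n => mul_ne_zero (pow_ne_zero _ ha) (pow_ne_zero _ hq0))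
      (fun n => 6 * n + 7) (fun n => by omega) fun n => by ring
  have s4 : Summable fun n : ℕ =>
      a ^ (3 * n + 1) * q ^ (n * (3 * n + 2)) * (1 - a * q ^ (2 * n + 1)) :=
    (s2.sub s3).congr fun n => by ring
  obtain ⟨C, hC⟩ := sT_bd hq hq0 h
  have bd : ∀ m : ℕ, ‖∑' n, sT q (a * q ^ m) n‖ ≤ ∑' n : ℕ, C * ‖q‖ ^ n := fun m =>
    tsum_of_norm_bounded
      ((summable_geometric_of_lt_one (norm_nonneg _) hq).mul_left C).hasSum fun n => hC n m
  have t0 : Tendsto (fun N : ℕ => a ^ N * q ^ (N * (N + 1)) * ∑' n, sT q (a * q ^ (2 * N)) n)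
      atTop (𝓝 0) := by
    refine squeeze_zero_norm (a := fun N : ℕ => ‖a ^ N * q ^ (N * (N + 1))‖ *
      ∑' n : ℕ, C * ‖q‖ ^ n) (fun N => ?_) ?_
    · rw [norm_mul]
      exact mul_le_mul_of_nonneg_left (bd _) (norm_nonneg _)
    · simpa using s1.tendsto_atTop_zero.norm.mul_const (∑' n : ℕ, C * ‖q‖ ^ n)
  have t := (s1.hasSum.tendsto_sum_nat.add (s4.hasSum.tendsto_sum_nat.div_const
    (qPochInf a q * qPochInf (q / a) q))).add t0
  rw [add_zero] at t
  exact tendsto_nhds_unique tendsto_const_nhds (t.congr fun N => (S_iter hq hq0 h N).symm)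
end

section
/- Ramanujan's partial theta identity: Σ_{n≥0} q^n / ((1-a) ∏_{j=1}^n (1-aq^j)(1-q^j/a)) = Σ_{n≥0} (-1)^n a^{3n} q^{n(3n+1)/2} (1 - a^2 q^{2n+1}) + (Σ_{n≥0} (-1)^n a^{2n+1} q^{n(n+1)/2}) / ∏_{j≥1} (1-aq^{j-1})(1-q^j/a). -/
open scoped BigOperators

namespace PT
open Filter Topology

def Good (q a : ℂ) : Prop := a ≠ 0 ∧ ∀ n : ℤ, a ≠ q ^ n

noncomputable def dd (q a : ℂ) (n : ℕ) : ℂ :=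
  (1 - a) * ∏ j ∈ Finset.range n, ((1 - a * q ^ (j + 1)) * (1 - q ^ (j + 1) / a))

noncomputable def th (q a : ℂ) : ℂ := ∏' j : ℕ, ((1 - a * q ^ j) * (1 - q ^ (j + 1) / a))

noncomputable def FF (q a : ℂ) : ℂ := ∑' n : ℕ, q ^ n / dd q a n

noncomputable def TT (q a : ℂ) : ℂ :=
  ∑' n : ℕ, (-1 : ℂ) ^ n * a ^ (3 * n) * q ^ (n * (3 * n + 1) / 2) *
            (1 - a ^ 2 * q ^ (2 * n + 1))

noncomputable def SS (q a : ℂ) : ℂ :=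
  ∑' n : ℕ, (-1 : ℂ) ^ n * a ^ (2 * n + 1) * q ^ (n * (n + 1) / 2)

lemma tri (n : ℕ) : (n + 1) * (n + 1 + 1) / 2 = n * (n + 1) / 2 + (n + 1) := by
  have : (n + 1) * (n + 1 + 1) = n * (n + 1) + (n + 1) * 2 := by ring
  rw [this, Nat.add_mul_div_right _ _ (by norm_num)]

lemma pent (n : ℕ) : (n + 1) * (3 * (n + 1) + 1) / 2 = n * (3 * n + 1) / 2 + (3 * n + 2) := by
  have : (n + 1) * (3 * (n + 1) + 1) = n * (3 * n + 1) + (3 * n + 2) * 2 := by ring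
  rw [this, Nat.add_mul_div_right _ _ (by norm_num)]

lemma good_shift {q a : ℂ} (hq0 : q ≠ 0) (h : Good q a) : Good q (a * q) := by
  refine ⟨mul_ne_zero h.1 hq0, fun n hn => h.2 (n - 1) ?_⟩
  rw [zpow_sub_one₀ hq0, ← hn]
  field_simp

lemma good_shift_pow {q a : ℂ} (hq0 : q ≠ 0) (h : Good q a) (m : ℕ) : Good q (a * q ^ m) := by
  induction m with
  | zero => simpa using h
  | succ k ih =>
    have := good_shift hq0 ih
    rwa [mul_assoc, ← pow_succ] at this

lemma ne1 {q a : ℂ} (hq0 : q ≠ 0) (h : Good q a) (j : ℕ) : 1 - a * q ^ j ≠ 0 := by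
  intro h0
  apply h.2 (-(j : ℤ))
  rw [zpow_neg, zpow_natCast]
  have : q ^ j ≠ 0 := pow_ne_zero _ hq0
  field_simp
  linear_combination -h0

lemma ne2 {q a : ℂ} (h : Good q a) (j : ℕ) : q ^ j - a ≠ 0 := by
  intro h0
  apply h.2 j
  rw [zpow_natCast]
  linear_combination -h0

lemma ne3 {q a : ℂ} (h : Good q a) (j : ℕ) : 1 - q ^ j / a ≠ 0 := by
  have := ne2 h j
  have h1 := h.1
  intro h0
  apply this
  field_simp at h0
  linear_combination -h0

lemma dd_succ (q a : ℂ) (n : ℕ) :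
    dd q a (n + 1) = dd q a n * ((1 - a * q ^ (n + 1)) * (1 - q ^ (n + 1) / a)) := by
  simp only [dd, Finset.prod_range_succ]; ring

lemma dd_ne {q a : ℂ} (hq0 : q ≠ 0) (h : Good q a) (n : ℕ) : dd q a n ≠ 0 := by
  induction n with
  | zero => simpa [dd] using ne1 hq0 h 0
  | succ k ih =>
    rw [dd_succ]
    exact mul_ne_zero ih (mul_ne_zero (ne1 hq0 h _) (ne3 h _))

lemma dd_shift {q a : ℂ} (hq0 : q ≠ 0) (h : Good q a) (n : ℕ) :
    dd q (a * q) n * (q ^ n - a) = dd q a n * (1 - a * q ^ (n + 1)) := by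
  have ha := h.1
  induction n with
  | zero => simp [dd]; ring
  | succ k ih =>
    rw [dd_succ, dd_succ]
    have e : 1 - q ^ (k + 1) / (a * q) = (q ^ k - a) * (-1 / a) := by
      field_simp; ring
    have e2 : 1 - q ^ (k + 1) / a = (q ^ (k + 1) - a) * (-1 / a) := by
      field_simp; ring
    rw [e, e2]
    linear_combination (1 - a * q ^ (k + 2)) * (-1 / a) * (q ^ (k + 1) - a) * ih

lemma dd_shift_inv {q a : ℂ} (hq0 : q ≠ 0) (h : Good q a) (n : ℕ) :
    (dd q (a * q) n)⁻¹ = (q ^ n - a) / (1 - a * q ^ (n + 1)) * (dd q a n)⁻¹ := by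
  have h1 := dd_ne hq0 h n
  have h2 := dd_ne hq0 (good_shift hq0 h) n
  have h3 := ne1 hq0 h (n + 1)
  field_simp
  linear_combination -(dd_shift hq0 h n)

lemma dd_eq (q a : ℂ) (n : ℕ) :
    dd q a n = (∏ j ∈ Finset.range n, ((1 - a * q ^ j) * (1 - q ^ (j + 1) / a)))
      * (1 - a * q ^ n) := by
  induction n with
  | zero => simp [dd]
  | succ k ih => rw [dd_succ, ih, Finset.prod_range_succ]; ring

lemma qpow_tendsto {q : ℂ} (hq : ‖q‖ < 1) : Tendsto (fun n : ℕ => q ^ n) atTop (𝓝 0) :=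
  tendsto_pow_atTop_nhds_zero_of_norm_lt_one hq

lemma one_sub_tendsto {q : ℂ} (a : ℂ) (hq : ‖q‖ < 1) :
    Tendsto (fun n : ℕ => 1 - a * q ^ n) atTop (𝓝 1) := by
  simpa using ((qpow_tendsto hq).const_mul a).const_sub 1

lemma summ1 {q : ℂ} (a : ℂ) (hq : ‖q‖ < 1) :
    Summable (fun j : ℕ => ‖-(a * q ^ j)‖) := by
  simp only [norm_neg, norm_mul, norm_pow]
  exact (summable_geometric_of_lt_one (norm_nonneg _) hq).mul_left _

lemma mult1 {q : ℂ} (a : ℂ) (hq : ‖q‖ < 1) : Multipliable (fun j : ℕ => 1 - a * q ^ j) := by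
  simpa [sub_eq_add_neg] using multipliable_one_add_of_summable (summ1 a hq)

lemma mult2 {q : ℂ} (a : ℂ) (hq : ‖q‖ < 1) :
    Multipliable (fun j : ℕ => 1 - q ^ (j + 1) / a) := by
  convert mult1 (q / a) hq using 2
  ring

lemma th_ne {q a : ℂ} (hq : ‖q‖ < 1) (hq0 : q ≠ 0) (h : Good q a) : th q a ≠ 0 := by
  rw [th, Multipliable.tprod_mul (mult1 a hq) (mult2 a hq)]
  refine mul_ne_zero ?_ ?_
  · have := tprod_one_add_ne_zero_of_summable (f := fun j : ℕ => -(a * q ^ j))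
      (fun i => by simpa [sub_eq_add_neg] using ne1 hq0 h i) (summ1 a hq)
    simpa [sub_eq_add_neg] using this
  · have e : (fun j : ℕ => 1 - q ^ (j + 1) / a) = fun j : ℕ => 1 + -(q / a * q ^ j) := by
      funext j; ring
    rw [e]
    refine tprod_one_add_ne_zero_of_summable (f := fun j : ℕ => -(q / a * q ^ j))
      (fun i => ?_) (summ1 (q / a) hq)
    rw [← congrFun e i]
    exact ne3 h _

lemma dd_tendsto {q : ℂ} (a : ℂ) (hq : ‖q‖ < 1) :
    Tendsto (dd q a) atTop (𝓝 (th q a)) := by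
  have h1 := ((mult1 a hq).mul (mult2 a hq)).tendsto_prod_tprod_nat
  have h2 := h1.mul (one_sub_tendsto a hq)
  rw [mul_one] at h2
  exact h2.congr fun n => (dd_eq q a n).symm

lemma ddinv_tendsto {q a : ℂ} (hq : ‖q‖ < 1) (hq0 : q ≠ 0) (h : Good q a) :
    Tendsto (fun n => (dd q a n)⁻¹) atTop (𝓝 (th q a)⁻¹) :=
  (dd_tendsto a hq).inv₀ (th_ne hq hq0 h)

lemma th_shift {q a : ℂ} (hq : ‖q‖ < 1) (hq0 : q ≠ 0) (h : Good q a) :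
    (th q (a * q))⁻¹ = -a * (th q a)⁻¹ := by
  refine tendsto_nhds_unique (ddinv_tendsto hq hq0 (good_shift hq0 h)) ?_
  have h1 : Tendsto (fun n : ℕ => (q ^ n - a) / (1 - a * q ^ (n + 1))) atTop (𝓝 ((0 - a) / 1)) :=
    ((qpow_tendsto hq).sub_const a).div
      ((tendsto_add_atTop_iff_nat 1).2 (one_sub_tendsto a hq)) one_ne_zero
  have h2 := h1.mul (ddinv_tendsto hq hq0 h)
  rw [zero_sub, div_one] at h2
  exact h2.congr fun n => (dd_shift_inv hq0 h n).symm

lemma F_summ {q a : ℂ} (hq : ‖q‖ < 1) (hq0 : q ≠ 0) (h : Good q a) :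
    Summable (fun n : ℕ => ‖q ^ n / dd q a n‖) := by
  obtain ⟨C, hC⟩ := (ddinv_tendsto hq hq0 h).norm.bddAbove_range
  refine Summable.of_nonneg_of_le (fun _ => norm_nonneg _) (fun n => ?_)
    ((summable_geometric_of_lt_one (norm_nonneg _) hq).mul_right C)
  rw [div_eq_mul_inv, norm_mul, norm_pow]
  exact mul_le_mul_of_nonneg_left (hC ⟨n, rfl⟩) (by positivity)

/-- The functional equation of the left side. -/
lemma F_eq {q a : ℂ} (hq : ‖q‖ < 1) (hq0 : q ≠ 0) (h : Good q a) :
    FF q a + a ^ 3 * q ^ 2 * FF q (a * q) = (1 - a ^ 2 * q) * (1 + a * (th q a)⁻¹) := by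
  have ha := h.1
  have s1 := (F_summ hq hq0 h).of_norm.hasSum
  have s2 := ((F_summ hq hq0 (good_shift hq0 h)).of_norm.hasSum).mul_left (a ^ 3 * q ^ 2)
  have s3 := (s1.add s2).tendsto_sum_nat
  refine tendsto_nhds_unique s3 ?_
  have key : ∀ N : ℕ, ∑ n ∈ Finset.range N, (q ^ n / dd q a n
      + a ^ 3 * q ^ 2 * (q ^ n / dd q (a * q) n))
      = (1 - a ^ 2 * q) * (1 + (a - q ^ N) * (dd q a N)⁻¹) := by
    intro N
    induction N with
    | zero =>
      have := ne1 hq0 h 0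
      simp only [pow_zero, mul_one] at this
      simp [dd]
      field_simp
      right; ring
    | succ k ih =>
      rw [Finset.sum_range_succ, ih, div_eq_mul_inv, div_eq_mul_inv, dd_shift_inv hq0 h, dd_succ]
      have h1 := dd_ne hq0 h k
      have h2 := ne1 hq0 h (k + 1)
      have h3 := ne2 h (k + 1)
      have e2 : 1 - q ^ (k + 1) / a = (q ^ (k + 1) - a) * (-1 / a) := by
        field_simp; ring
      rw [e2]
      field_simp
      ring
  have h4 : Tendsto (fun N : ℕ => (1 - a ^ 2 * q) * (1 + (a - q ^ N) * (dd q a N)⁻¹)) atTop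
      (𝓝 ((1 - a ^ 2 * q) * (1 + (a - 0) * (th q a)⁻¹))) :=
    ((((qpow_tendsto hq).const_sub a).mul (ddinv_tendsto hq hq0 h)).const_add 1).const_mul _
  rw [sub_zero] at h4
  exact h4.congr fun N => (key N).symm

lemma summ_gauss {r : ℝ} (A : ℝ) (h0 : 0 < r) (h1 : r < 1) (hA : 0 < A) :
    Summable (fun n : ℕ => A ^ n * r ^ (n * (n + 1) / 2)) := by
  refine summable_of_ratio_test_tendsto_lt_one (l := 0) zero_lt_one ?_ ?_
  · exact Eventually.of_forall fun n => by positivity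
  · have : Tendsto (fun n : ℕ => A * r * r ^ n) atTop (𝓝 0) := by
      simpa using (tendsto_pow_atTop_nhds_zero_of_lt_one h0.le h1).const_mul (A * r)
    refine this.congr fun n => ?_
    rw [Real.norm_of_nonneg (by positivity), Real.norm_of_nonneg (by positivity), tri]
    field_simp
    ring

lemma T_bd {q a : ℂ} (hq : ‖q‖ < 1) {R : ℝ} (hR : ‖a‖ ≤ R) (n : ℕ) :
    ‖(-1 : ℂ) ^ n * a ^ (3 * n) * q ^ (n * (3 * n + 1) / 2) *
            (1 - a ^ 2 * q ^ (2 * n + 1))‖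
      ≤ (R ^ 3) ^ n * ‖q‖ ^ (n * (n + 1) / 2) * (1 + R ^ 2) := by
  have hR0 : 0 ≤ R := (norm_nonneg _).trans hR
  simp only [norm_mul, norm_pow, norm_neg, norm_one, one_pow, one_mul]
  have e1 : ‖a‖ ^ (3 * n) ≤ (R ^ 3) ^ n := by rw [← pow_mul]; gcongr
  have e2 : ‖q‖ ^ (n * (3 * n + 1) / 2) ≤ ‖q‖ ^ (n * (n + 1) / 2) :=
    pow_le_pow_of_le_one (norm_nonneg _) hq.le
      (Nat.div_le_div_right (Nat.mul_le_mul_left _ (by omega)))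
  have e3 : ‖1 - a ^ 2 * q ^ (2 * n + 1)‖ ≤ 1 + R ^ 2 := by
    refine (norm_sub_le _ _).trans ?_
    rw [norm_one, norm_mul, norm_pow, norm_pow]
    have : ‖q‖ ^ (2 * n + 1) ≤ 1 := pow_le_one₀ (norm_nonneg _) hq.le
    have : ‖a‖ ^ 2 * ‖q‖ ^ (2 * n + 1) ≤ R ^ 2 * 1 := by gcongr
    linarith
  gcongr

lemma S_bd {q a : ℂ} {R : ℝ} (hR : ‖a‖ ≤ R) (n : ℕ) :
    ‖(-1 : ℂ) ^ n * a ^ (2 * n + 1) * q ^ (n * (n + 1) / 2)‖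
      ≤ (R ^ 2) ^ n * ‖q‖ ^ (n * (n + 1) / 2) * R := by
  have hR0 : 0 ≤ R := (norm_nonneg _).trans hR
  simp only [norm_mul, norm_pow, norm_neg, norm_one, one_pow, one_mul]
  have e1 : ‖a‖ ^ (2 * n + 1) ≤ (R ^ 2) ^ n * R := by rw [← pow_mul, ← pow_succ]; gcongr
  calc _ ≤ (R ^ 2) ^ n * R * ‖q‖ ^ (n * (n + 1) / 2) := by gcongr
    _ = _ := by ring

lemma T_eq {q a : ℂ} (hq : ‖q‖ < 1) (hq0 : q ≠ 0) (h : Good q a) :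
    TT q a + a ^ 3 * q ^ 2 * TT q (a * q) = 1 - a ^ 2 * q := by
  have hr : 0 < ‖q‖ := norm_pos_iff.2 hq0
  have hR : 0 < ‖a‖ := norm_pos_iff.2 h.1
  have s := Summable.of_norm_bounded
    ((summ_gauss (‖a‖ ^ 3) hr hq (by positivity)).mul_right _) (T_bd (a := a) hq le_rfl)
  rw [TT, s.tsum_eq_zero_add, TT, ← tsum_mul_left]
  have : ∀ n : ℕ, (-1 : ℂ) ^ (n + 1) * a ^ (3 * (n + 1)) *
      q ^ ((n + 1) * (3 * (n + 1) + 1) / 2) * (1 - a ^ 2 * q ^ (2 * (n + 1) + 1))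
      = -(a ^ 3 * q ^ 2 * ((-1 : ℂ) ^ n * (a * q) ^ (3 * n) * q ^ (n * (3 * n + 1) / 2) *
            (1 - (a * q) ^ 2 * q ^ (2 * n + 1)))) := by
    intro n
    rw [pent, mul_pow]
    ring
  rw [tsum_congr this, tsum_neg]
  simp

lemma S_eq {q a : ℂ} (hq : ‖q‖ < 1) (hq0 : q ≠ 0) (h : Good q a) :
    SS q a - a ^ 4 * q ^ 2 * SS q (a * q) = a * (1 - a ^ 2 * q) := by
  have hr : 0 < ‖q‖ := norm_pos_iff.2 hq0
  have hR : 0 < ‖a‖ := norm_pos_iff.2 h.1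
  have s := Summable.of_norm_bounded
    ((summ_gauss (‖a‖ ^ 2) hr hq (by positivity)).mul_right _) (S_bd (q := q) (a := a) le_rfl)
  rw [SS, ← s.sum_add_tsum_nat_add 2, SS, ← tsum_mul_left]
  have : ∀ n : ℕ, (-1 : ℂ) ^ (n + 2) * a ^ (2 * (n + 2) + 1) *
      q ^ ((n + 2) * (n + 2 + 1) / 2)
      = a ^ 4 * q ^ 2 * ((-1 : ℂ) ^ n * (a * q) ^ (2 * n + 1) * q ^ (n * (n + 1) / 2)) := by
    intro n
    rw [show n + 2 = n + 1 + 1 from rfl, tri, tri, mul_pow]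
    ring
  rw [tsum_congr this]
  simp [Finset.sum_range_succ]
  ring

noncomputable def HH (q a : ℂ) : ℂ := FF q a - TT q a - SS q a * (th q a)⁻¹

lemma H_eq {q a : ℂ} (hq : ‖q‖ < 1) (hq0 : q ≠ 0) (h : Good q a) :
    HH q a = -(a ^ 3 * q ^ 2) * HH q (a * q) := by
  simp only [HH]
  rw [th_shift hq hq0 h]
  linear_combination F_eq hq hq0 h - T_eq hq hq0 h - (th q a)⁻¹ * S_eq hq hq0 h

lemma H_norm {q a : ℂ} (hq : ‖q‖ < 1) (hq0 : q ≠ 0) (h : Good q a) (m : ℕ) :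
    ‖HH q a‖ ≤ (‖a‖ ^ 3) ^ m * ‖q‖ ^ (m * (m + 1) / 2) * ‖HH q (a * q ^ m)‖ := by
  induction m with
  | zero => simp
  | succ k ih =>
    refine ih.trans ?_
    rw [H_eq hq hq0 (good_shift_pow hq0 h k), tri, mul_assoc a, ← pow_succ]
    simp only [norm_mul, norm_neg, norm_pow]
    have e : (‖q‖ ^ k) ^ 3 * ‖q‖ ^ 2 ≤ ‖q‖ ^ (k + 1) := by
      rw [← pow_mul, ← pow_add]
      exact pow_le_pow_of_le_one (norm_nonneg _) hq.le (by omega)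
    calc _ = (‖a‖ ^ 3) ^ (k + 1) * ‖q‖ ^ (k * (k + 1) / 2) * ((‖q‖ ^ k) ^ 3 * ‖q‖ ^ 2)
          * ‖HH q (a * q ^ (k + 1))‖ := by ring
      _ ≤ (‖a‖ ^ 3) ^ (k + 1) * ‖q‖ ^ (k * (k + 1) / 2) * (‖q‖ ^ (k + 1))
          * ‖HH q (a * q ^ (k + 1))‖ := by gcongr
      _ = _ := by ring

lemma norm_shift {q : ℂ} (a : ℂ) (hq : ‖q‖ < 1) (m : ℕ) : ‖a * q ^ m‖ ≤ ‖a‖ := by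
  rw [norm_mul, norm_pow]
  exact mul_le_of_le_one_right (norm_nonneg _) (pow_le_one₀ (norm_nonneg _) hq.le)

lemma H_bound {q a : ℂ} (hq : ‖q‖ < 1) (hq0 : q ≠ 0) (h : Good q a) :
    ∃ C K : ℝ, 0 < K ∧ ∀ m : ℕ, ‖HH q (a * q ^ m)‖ ≤ C * K ^ m := by
  have hr : 0 < ‖q‖ := norm_pos_iff.2 hq0
  have hR : 0 < ‖a‖ := norm_pos_iff.2 h.1
  -- bound for the inverse of `1 - a q^j`
  obtain ⟨B, hB⟩ : ∃ B : ℝ, ∀ j : ℕ, ‖(1 - a * q ^ j)⁻¹‖ ≤ B := by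
    obtain ⟨B, hB⟩ := ((one_sub_tendsto a hq).inv₀ one_ne_zero).norm.bddAbove_range
    exact ⟨B, fun j => hB ⟨j, rfl⟩⟩
  have hB0 : 0 ≤ B := (norm_nonneg _).trans (hB 0)
  set K : ℝ := 1 + ‖a‖ + (1 + ‖a‖) * B with hK
  have hK1 : 1 ≤ K := by rw [hK]; nlinarith [mul_nonneg (by positivity : 0 ≤ 1 + ‖a‖) hB0]
  have hKa : ‖a‖ ≤ K := by rw [hK]; nlinarith [mul_nonneg (by positivity : 0 ≤ 1 + ‖a‖) hB0]
  have hKB : (1 + ‖a‖) * B ≤ K := by rw [hK]; linarith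
  have hdd : ∀ m n : ℕ, ‖(dd q (a * q ^ m) n)⁻¹‖ ≤ K ^ m * ‖(dd q a n)⁻¹‖ := by
    intro m n
    induction m with
    | zero => simp
    | succ k ih =>
      rw [pow_succ, ← mul_assoc a, dd_shift_inv hq0 (good_shift_pow hq0 h k), norm_mul,
        div_eq_mul_inv, norm_mul]
      have e1 : ‖q ^ n - a * q ^ k‖ ≤ 1 + ‖a‖ := by
        refine (norm_sub_le _ _).trans (add_le_add ?_ (norm_shift a hq k))
        rw [norm_pow]; exact pow_le_one₀ (norm_nonneg _) hq.le
      have e2 : ‖(1 - a * q ^ k * q ^ (n + 1))⁻¹‖ ≤ B := by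
        have := hB (k + (n + 1))
        rwa [pow_add, ← mul_assoc] at this
      calc _ ≤ (1 + ‖a‖) * B * (K ^ k * ‖(dd q a n)⁻¹‖) := by gcongr
        _ ≤ K * (K ^ k * ‖(dd q a n)⁻¹‖) := by gcongr
        _ = _ := by ring
  have hth : ∀ m : ℕ, ‖(th q (a * q ^ m))⁻¹‖ ≤ K ^ m * ‖(th q a)⁻¹‖ := by
    intro m
    exact le_of_tendsto_of_tendsto' (ddinv_tendsto hq hq0 (good_shift_pow hq0 h m)).norm
      ((ddinv_tendsto hq hq0 h).norm.const_mul _) (hdd m)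
  have hF : ∀ m : ℕ, ‖FF q (a * q ^ m)‖ ≤ K ^ m * ∑' n : ℕ, ‖q ^ n / dd q a n‖ := by
    intro m
    refine tsum_of_norm_bounded ((F_summ hq hq0 h).hasSum.mul_left _) fun n => ?_
    rw [div_eq_mul_inv, div_eq_mul_inv, norm_mul, norm_mul]
    calc _ ≤ ‖q ^ n‖ * (K ^ m * ‖(dd q a n)⁻¹‖) := by gcongr; exact hdd m n
      _ = _ := by ring
  have hT := fun m : ℕ => tsum_of_norm_bounded
    ((summ_gauss (‖a‖ ^ 3) hr hq (by positivity)).mul_right (1 + ‖a‖ ^ 2)).hasSum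
    (T_bd hq (norm_shift a hq m))
  have hS := fun m : ℕ => tsum_of_norm_bounded
    ((summ_gauss (‖a‖ ^ 2) hr hq (by positivity)).mul_right ‖a‖).hasSum
    (S_bd (q := q) (norm_shift a hq m))
  set CT := ∑' n : ℕ, (‖a‖ ^ 3) ^ n * ‖q‖ ^ (n * (n + 1) / 2) * (1 + ‖a‖ ^ 2)
  set CS := ∑' n : ℕ, (‖a‖ ^ 2) ^ n * ‖q‖ ^ (n * (n + 1) / 2) * ‖a‖
  refine ⟨(∑' n : ℕ, ‖q ^ n / dd q a n‖) + CT + CS * ‖(th q a)⁻¹‖, K, by linarith, fun m => ?_⟩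
  have hKm : 1 ≤ K ^ m := one_le_pow₀ hK1
  have hCT : 0 ≤ CT := (norm_nonneg _).trans (hT 0)
  have hCS : 0 ≤ CS := (norm_nonneg _).trans (hS 0)
  have hT' : ‖TT q (a * q ^ m)‖ ≤ CT := hT m
  have hS' : ‖SS q (a * q ^ m)‖ ≤ CS := hS m
  have hST : ‖SS q (a * q ^ m) * (th q (a * q ^ m))⁻¹‖ ≤ CS * (K ^ m * ‖(th q a)⁻¹‖) := by
    rw [norm_mul]
    exact mul_le_mul hS' (hth m) (norm_nonneg _) hCS
  have h1 : ‖HH q (a * q ^ m)‖ ≤ ‖FF q (a * q ^ m)‖ + ‖TT q (a * q ^ m)‖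
      + ‖SS q (a * q ^ m) * (th q (a * q ^ m))⁻¹‖ :=
    (norm_sub_le _ _).trans (add_le_add (norm_sub_le _ _) le_rfl)
  have h2 : CT ≤ CT * K ^ m := le_mul_of_one_le_right hCT hKm
  have := hF m
  nlinarith

lemma H_zero {q a : ℂ} (hq : ‖q‖ < 1) (hq0 : q ≠ 0) (h : Good q a) : HH q a = 0 := by
  have hr : 0 < ‖q‖ := norm_pos_iff.2 hq0
  have hR : 0 < ‖a‖ := norm_pos_iff.2 h.1
  obtain ⟨C, K, hK, hC⟩ := H_bound hq hq0 h
  have ht := ((summ_gauss (‖a‖ ^ 3 * K) hr hq (by positivity)).tendsto_atTop_zero).const_mul C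
  rw [mul_zero] at ht
  have : ‖HH q a‖ ≤ 0 := by
    refine ge_of_tendsto' ht fun m => (H_norm hq hq0 h m).trans ?_
    calc _ ≤ (‖a‖ ^ 3) ^ m * ‖q‖ ^ (m * (m + 1) / 2) * (C * K ^ m) := by gcongr; exact hC m
      _ = _ := by rw [mul_pow]; ring
  exact norm_le_zero_iff.1 this

end PT

/-- Ramanujan's partial theta identity \eqref{R0}. -/
theorem stmt_9 (q a : ℂ) (hq : ‖q‖ < 1) (hq0 : q ≠ 0) (ha : a ≠ 0)
    (ha' : ∀ n : ℤ, a ≠ q ^ n) :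
    ∑' n : ℕ, q ^ n /
        ((1 - a) * ∏ j ∈ Finset.range n, ((1 - a * q ^ (j + 1)) * (1 - q ^ (j + 1) / a)))
      = (∑' n : ℕ, (-1 : ℂ) ^ n * a ^ (3 * n) * q ^ (n * (3 * n + 1) / 2) *
            (1 - a ^ 2 * q ^ (2 * n + 1)))
        + (∑' n : ℕ, (-1 : ℂ) ^ n * a ^ (2 * n + 1) * q ^ (n * (n + 1) / 2))
            / ∏' j : ℕ, ((1 - a * q ^ j) * (1 - q ^ (j + 1) / a)) := by
  have h := PT.H_zero hq hq0 ⟨ha, ha'⟩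
  simp only [PT.HH, PT.FF, PT.TT, PT.SS, PT.dd, PT.th] at h
  rw [div_eq_mul_inv (∑' n : ℕ, (-1 : ℂ) ^ n * a ^ (2 * n + 1) * q ^ (n * (n + 1) / 2))]
  linear_combination h
end
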